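/- One has (1/(2π)) ∫_{λ₁≤λ₂≤λ₃≤λ₄} e^{-λ₁²/2} e^{-λ₂²/2} e^{-λ₃²/2} e^{-λ₄²} ∏_{1≤i<j≤4}(λ_j-λ_i) dλ₁ dλ₂ dλ₃ dλ₄ = (29√6 - 36)/144. Equivalently, E^{4}_{GOE}{ exp(-λ₄²/2) } = (29√6 - 36)/144, where λ₄ is the largest eigenvalue of a 4×4 GOE matrix. -/

import Mathlib

open MeasureTheory Real

open Filter Topology Set

/-- The unnormalised standard Gaussian weight. -/
noncomputable def gaussWeight (x : ℝ) : ℝ := exp (-(x ^ 2) / 2)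

/-- The primitive vanishing at `-∞` of the `k`-th power of the Gaussian weight. -/
noncomputable def gaussPrim (k : ℕ) (x : ℝ) : ℝ := ∫ t in Iic x, gaussWeight t ^ k

/-- Continuous functions of at most polynomial growth. -/
@[fun_prop]
def PolyGrowth (g : ℝ → ℝ) : Prop :=
  Continuous g ∧ ∃ (C : ℝ) (n : ℕ), 0 ≤ C ∧ ∀ x, |g x| ≤ C * (1 + x ^ 2) ^ n

namespace PolyGrowth

variable {f g : ℝ → ℝ}

lemma of_bounded {C : ℝ} (hf : Continuous f) (h : ∀ x, |f x| ≤ C) : PolyGrowth f :=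
  ⟨hf, C, 0, (abs_nonneg _).trans (h 0), fun x => by simpa using h x⟩

@[fun_prop]
lemma const (c : ℝ) : PolyGrowth (fun _ => c) := of_bounded continuous_const fun _ => le_rfl

@[fun_prop]
lemma id : PolyGrowth (fun x => x) := by
  refine ⟨continuous_id, 1, 1, zero_le_one, fun x => ?_⟩
  rw [abs_le]
  constructor <;> nlinarith [sq_nonneg (x - 1), sq_nonneg (x + 1)]

@[fun_prop]
lemma mul (hf : PolyGrowth f) (hg : PolyGrowth g) : PolyGrowth (fun x => f x * g x) := by
  obtain ⟨hf, C, n, hC, hCn⟩ := hf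
  obtain ⟨hg, D, m, hD, hDm⟩ := hg
  refine ⟨hf.mul hg, C * D, n + m, by positivity, fun x => ?_⟩
  rw [abs_mul]
  calc |f x| * |g x| ≤ (C * (1 + x ^ 2) ^ n) * (D * (1 + x ^ 2) ^ m) :=
        mul_le_mul (hCn x) (hDm x) (abs_nonneg _) (by positivity)
    _ = C * D * (1 + x ^ 2) ^ (n + m) := by ring

@[fun_prop]
lemma add (hf : PolyGrowth f) (hg : PolyGrowth g) : PolyGrowth (fun x => f x + g x) := by
  obtain ⟨hf, C, n, hC, hCn⟩ := hf
  obtain ⟨hg, D, m, hD, hDm⟩ := hg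
  refine ⟨hf.add hg, C + D, n + m, by positivity, fun x => ?_⟩
  have h1 : (1 : ℝ) ≤ 1 + x ^ 2 := by nlinarith [sq_nonneg x]
  calc |f x + g x| ≤ |f x| + |g x| := abs_add_le _ _
    _ ≤ C * (1 + x ^ 2) ^ n + D * (1 + x ^ 2) ^ m := add_le_add (hCn x) (hDm x)
    _ ≤ C * (1 + x ^ 2) ^ (n + m) + D * (1 + x ^ 2) ^ (n + m) := by
        gcongr <;> first | exact h1 | omega
    _ = (C + D) * (1 + x ^ 2) ^ (n + m) := by ring

@[fun_prop]
lemma neg (hf : PolyGrowth f) : PolyGrowth (fun x => -f x) := by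
  simpa using (const (-1)).mul hf

@[fun_prop]
lemma sub (hf : PolyGrowth f) (hg : PolyGrowth g) : PolyGrowth (fun x => f x - g x) := by
  simpa [sub_eq_add_neg] using hf.add hg.neg

@[fun_prop]
lemma pow (hf : PolyGrowth f) (n : ℕ) : PolyGrowth (fun x => f x ^ n) := by
  induction n with
  | zero => simpa using const 1
  | succ n ih => simpa [pow_succ] using ih.mul hf

end PolyGrowth

lemma continuous_gaussWeight : Continuous gaussWeight := by
  unfold gaussWeight; fun_prop

lemma gaussWeight_pos (x : ℝ) : 0 < gaussWeight x := exp_pos _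

lemma gaussWeight_neg (x : ℝ) : gaussWeight (-x) = gaussWeight x := by simp [gaussWeight]

lemma gaussWeight_sq (x : ℝ) : gaussWeight x ^ 2 = exp (-(x ^ 2)) := by
  rw [gaussWeight, ← exp_nat_mul]; congr 1; push_cast; ring

lemma hasDerivAt_gaussWeight (x : ℝ) : HasDerivAt gaussWeight (-x * gaussWeight x) x := by
  have h := (((hasDerivAt_id x).pow 2).neg.div_const 2).exp
  refine h.congr_deriv ?_
  simp [gaussWeight]; ring

@[fun_prop]
lemma polyGrowth_gaussWeight : PolyGrowth gaussWeight := by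
  refine .of_bounded (C := 1) continuous_gaussWeight fun x => ?_
  rw [abs_of_pos (gaussWeight_pos x), gaussWeight, exp_le_one_iff]
  nlinarith [sq_nonneg x]

lemma PolyGrowth.abs_mul_gaussWeight_le {g : ℝ → ℝ} (hg : PolyGrowth g) :
    ∃ C, ∀ x, |g x * gaussWeight x| ≤ C * (1 + x ^ 2)⁻¹ := by
  obtain ⟨-, C, n, hC, h⟩ := hg
  refine ⟨C * ((n + 1).factorial * 2 ^ (n + 1) * exp (1 / 2)), fun x => ?_⟩
  have hu : (0 : ℝ) < 1 + x ^ 2 := by positivity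
  have h1 := pow_div_factorial_le_exp (x := (1 + x ^ 2) / 2) (by positivity) (n + 1)
  have h2 : (1 + x ^ 2) ^ (n + 1) ≤
      (n + 1).factorial * 2 ^ (n + 1) * exp ((1 + x ^ 2) / 2) := by
    rw [div_pow, div_div, div_le_iff₀ (by positivity)] at h1
    linarith
  have h3 : exp ((1 + x ^ 2) / 2) * gaussWeight x = exp (1 / 2) := by
    rw [gaussWeight, ← exp_add]; congr 1; ring
  rw [← div_eq_mul_inv, le_div_iff₀ hu, abs_mul, abs_of_pos (gaussWeight_pos x)]
  calc |g x| * gaussWeight x * (1 + x ^ 2)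
      ≤ C * (1 + x ^ 2) ^ n * gaussWeight x * (1 + x ^ 2) := by
        gcongr
        · exact (gaussWeight_pos x).le
        · exact h x
    _ = C * ((1 + x ^ 2) ^ (n + 1) * gaussWeight x) := by ring
    _ ≤ C * ((n + 1).factorial * 2 ^ (n + 1) * exp ((1 + x ^ 2) / 2) * gaussWeight x) := by
        gcongr
        exact (gaussWeight_pos x).le
    _ = _ := by rw [mul_assoc _ (exp _), h3]

lemma PolyGrowth.integrable_mul_gaussWeight {g : ℝ → ℝ} (hg : PolyGrowth g) :
    Integrable fun x => g x * gaussWeight x := by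
  obtain ⟨C, hC⟩ := hg.abs_mul_gaussWeight_le
  exact (integrable_inv_one_add_sq.const_mul C).mono'
    (hg.1.mul continuous_gaussWeight).aestronglyMeasurable (ae_of_all _ hC)

lemma PolyGrowth.tendsto_mul_gaussWeight {g : ℝ → ℝ} (hg : PolyGrowth g) {l : Filter ℝ}
    (hl : Tendsto (fun x : ℝ => x ^ 2) l atTop) :
    Tendsto (fun x => g x * gaussWeight x) l (𝓝 0) := by
  obtain ⟨C, hC⟩ := hg.abs_mul_gaussWeight_le
  refine squeeze_zero_norm hC ?_
  simpa using (tendsto_inv_atTop_zero.comp (tendsto_atTop_add_const_left l 1 hl)).const_mul C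

lemma tendsto_sq_atBot : Tendsto (fun x : ℝ => x ^ 2) atBot atTop :=
  ((tendsto_pow_atTop two_ne_zero).comp tendsto_neg_atBot_atTop).congr fun x => by simp

lemma integrable_gaussWeight_pow (k : ℕ) [NeZero k] : Integrable fun x => gaussWeight x ^ k := by
  obtain ⟨m, rfl⟩ := Nat.exists_eq_succ_of_ne_zero (NeZero.ne k)
  simpa [pow_succ] using
    (show PolyGrowth fun x => gaussWeight x ^ m by fun_prop).integrable_mul_gaussWeight

lemma integral_gaussWeight_pow (k : ℕ) : ∫ x, gaussWeight x ^ k = √(π / (k / 2)) := by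
  rw [← integral_gaussian]
  congr 1 with x
  rw [gaussWeight, ← exp_nat_mul]; congr 1; ring

lemma hasDerivAt_gaussPrim (k : ℕ) [NeZero k] (x : ℝ) :
    HasDerivAt (gaussPrim k) (gaussWeight x ^ k) x := by
  have hc : Continuous fun x => gaussWeight x ^ k := continuous_gaussWeight.pow k
  have h := (hc.integral_hasStrictDerivAt 0 x).hasDerivAt.add_const (gaussPrim k 0)
  refine h.congr_of_eventuallyEq (Eventually.of_forall fun y => ?_)
  have hi := integrable_gaussWeight_pow k
  simp only [gaussPrim]
  rw [← intervalIntegral.integral_Iic_sub_Iic hi.integrableOn hi.integrableOn]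
  ring

lemma tendsto_gaussPrim_atBot (k : ℕ) : Tendsto (gaussPrim k) atBot (𝓝 0) :=
  tendsto_integral_Iic_zero tendsto_id

@[fun_prop]
lemma polyGrowth_gaussPrim (k : ℕ) [NeZero k] : PolyGrowth (gaussPrim k) := by
  have hn : ∀ t, 0 ≤ gaussWeight t ^ k := fun t => pow_nonneg (gaussWeight_pos t).le k
  refine .of_bounded (C := ∫ t, gaussWeight t ^ k)
    (continuous_iff_continuousAt.2 fun x => (hasDerivAt_gaussPrim k x).continuousAt) fun x => ?_
  rw [gaussPrim, abs_of_nonneg (integral_nonneg hn)]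
  exact setIntegral_le_integral (integrable_gaussWeight_pow k) (ae_of_all _ hn)

lemma gaussPrim_add_gaussPrim_neg (k : ℕ) [NeZero k] (x : ℝ) :
    gaussPrim k x + gaussPrim k (-x) = ∫ t, gaussWeight t ^ k := by
  have h := integral_comp_neg_Iic (-x) fun t => gaussWeight t ^ k
  simp only [gaussWeight_neg, neg_neg] at h
  rw [gaussPrim, gaussPrim, h, ← compl_Iic]
  exact integral_add_compl measurableSet_Iic (integrable_gaussWeight_pow k)

lemma integrable_gaussWeight_pow_mul_gaussPrim (m k : ℕ) [NeZero m] [NeZero k] :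
    Integrable fun x => gaussWeight x ^ m * gaussPrim k x := by
  obtain ⟨m, rfl⟩ := Nat.exists_eq_succ_of_ne_zero (NeZero.ne m)
  have h : PolyGrowth fun x => gaussWeight x ^ m * gaussPrim k x := by fun_prop
  refine h.integrable_mul_gaussWeight.congr (ae_of_all _ fun x => ?_)
  simp only [Nat.succ_eq_add_one, pow_succ]; ring

lemma integral_gaussWeight_pow_mul_gaussPrim (m k : ℕ) [NeZero m] [NeZero k] :
    ∫ x, gaussWeight x ^ m * gaussPrim k x = √(π / (m / 2)) * √(π / (k / 2)) / 2 := by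
  have hi := integrable_gaussWeight_pow_mul_gaussPrim m k
  have hneg : ∫ x, gaussWeight x ^ m * gaussPrim k (-x) =
      ∫ x, gaussWeight x ^ m * gaussPrim k x := by
    simpa [gaussWeight_neg] using
      integral_neg_eq_self (fun x => gaussWeight x ^ m * gaussPrim k x) volume
  have hi' : Integrable fun x => gaussWeight x ^ m * gaussPrim k (-x) := by
    simpa [gaussWeight_neg] using hi.comp_neg
  have hsum := integral_add hi hi'
  simp only [← mul_add, gaussPrim_add_gaussPrim_neg, integral_mul_const,
    integral_gaussWeight_pow, hneg] at hsum
  linarith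

lemma hasDerivAt_quadratic (a b c x : ℝ) :
    HasDerivAt (fun t => a + b * t + c * t ^ 2) (b + 2 * c * x) x := by
  have h := (((hasDerivAt_id x).const_mul b).const_add a).add
    (((hasDerivAt_id x).pow 2).const_mul c)
  refine h.congr_deriv ?_
  simp; ring

/-- The fundamental theorem of calculus on a lower half-line for an antiderivative which is the
sum of a rapidly decaying function and of a function vanishing at `-∞`. -/
lemma integral_Iic_gaussWeight {f g B K : ℝ → ℝ} (hg : PolyGrowth g) (hB : PolyGrowth B)
    (hK : Tendsto K atBot (𝓝 0)) (hf : ∀ t, f t = g t * gaussWeight t)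
    (hH : ∀ t, HasDerivAt (fun t => B t * gaussWeight t + K t) (g t * gaussWeight t) t) (x : ℝ) :
    ∫ t in Iic x, f t = B x * gaussWeight x + K x := by
  rw [funext hf, integral_Iic_of_hasDerivAt_of_tendsto' (fun t _ => hH t)
    hg.integrable_mul_gaussWeight.integrableOn
    (by simpa using (hB.tendsto_mul_gaussWeight tendsto_sq_atBot).add hK), sub_zero]

lemma integral_gaussWeight_eq_zero {g B : ℝ → ℝ} (hg : PolyGrowth g) (hB : PolyGrowth B)
    (hH : ∀ t, HasDerivAt (fun t => B t * gaussWeight t) (g t * gaussWeight t) t) :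
    ∫ t, g t * gaussWeight t = 0 := by
  rw [integral_of_hasDerivAt_of_tendsto hH hg.integrable_mul_gaussWeight
    (hB.tendsto_mul_gaussWeight tendsto_sq_atBot)
    (hB.tendsto_mul_gaussWeight (tendsto_pow_atTop two_ne_zero)), sub_zero]

lemma integral_smallest_eigenvalue (x y z : ℝ) :
    ∫ t in Iic x, gaussWeight t * gaussWeight x * gaussWeight y * gaussWeight z ^ 2 *
        ((x - t) * (y - t) * (z - t) * (y - x) * (z - x) * (z - y)) =
      gaussWeight x * gaussWeight y * gaussWeight z ^ 2 *
        ((2 * y * z ^ 2 - 2 * y ^ 2 * z + y ^ 2 * z ^ 3 - y ^ 3 * z ^ 2 - 2 * x * z ^ 2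
            - x * y * z ^ 3 + 2 * x * y ^ 2 + x * y ^ 3 * z + 2 * x ^ 2 * z - 2 * x ^ 2 * y
            + x ^ 2 * y * z ^ 2 - x ^ 2 * y ^ 2 * z) * gaussWeight x
          + (y * z ^ 3 - y ^ 3 * z - x * z ^ 3 + x * y ^ 2 * z ^ 3 + x * y ^ 3 - x * y ^ 3 * z ^ 2
            - x ^ 2 * y * z ^ 3 + x ^ 2 * y ^ 3 * z + x ^ 3 * z - x ^ 3 * y + x ^ 3 * y * z ^ 2
            - x ^ 3 * y ^ 2 * z) * gaussPrim 1 x) := by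
  set c := gaussWeight x * gaussWeight y * gaussWeight z ^ 2 with hc
  set a₀ := 2 * y * z ^ 2 - 2 * y ^ 2 * z + y ^ 2 * z ^ 3 - y ^ 3 * z ^ 2 - 2 * x * z ^ 2
    + 2 * x * y ^ 2 + 2 * x ^ 2 * z - x ^ 2 * z ^ 3 - 2 * x ^ 2 * y + x ^ 2 * y ^ 3
    + x ^ 3 * z ^ 2 - x ^ 3 * y ^ 2 with ha₀
  set a₁ := -y * z ^ 3 + y ^ 3 * z + x * z ^ 3 - x * y ^ 3 - x ^ 3 * z + x ^ 3 * y with ha₁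
  set a₂ := y * z ^ 2 - y ^ 2 * z - x * z ^ 2 + x * y ^ 2 + x ^ 2 * z - x ^ 2 * y with ha₂
  set e := y * z ^ 3 - y ^ 3 * z - x * z ^ 3 + x * y ^ 2 * z ^ 3 + x * y ^ 3 - x * y ^ 3 * z ^ 2
    - x ^ 2 * y * z ^ 3 + x ^ 2 * y ^ 3 * z + x ^ 3 * z - x ^ 3 * y + x ^ 3 * y * z ^ 2
    - x ^ 3 * y ^ 2 * z with he
  rw [integral_Iic_gaussWeight
    (g := fun t => c * ((x - t) * (y - t) * (z - t) * (y - x) * (z - x) * (z - y)))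
    (B := fun t => c * (a₀ + a₁ * t + a₂ * t ^ 2)) (K := fun t => c * e * gaussPrim 1 t)
    (by fun_prop) (by fun_prop) (by simpa using (tendsto_gaussPrim_atBot 1).const_mul (c * e))
    (fun t => by rw [hc]; ring) (fun t => ?_)]
  · rw [ha₀, ha₁, ha₂]; ring
  · refine ((((hasDerivAt_quadratic a₀ a₁ a₂ t).const_mul c).mul (hasDerivAt_gaussWeight t)).add
      ((hasDerivAt_gaussPrim 1 t).const_mul (c * e))).congr_deriv ?_
    rw [ha₀, ha₁, ha₂, he]; ring

lemma integral_second_eigenvalue (y z : ℝ) :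
    ∫ t in Iic y, gaussWeight t * gaussWeight y * gaussWeight z ^ 2 *
        ((2 * y * z ^ 2 - 2 * y ^ 2 * z + y ^ 2 * z ^ 3 - y ^ 3 * z ^ 2 - 2 * t * z ^ 2
            - t * y * z ^ 3 + 2 * t * y ^ 2 + t * y ^ 3 * z + 2 * t ^ 2 * z - 2 * t ^ 2 * y
            + t ^ 2 * y * z ^ 2 - t ^ 2 * y ^ 2 * z) * gaussWeight t
          + (y * z ^ 3 - y ^ 3 * z - t * z ^ 3 + t * y ^ 2 * z ^ 3 + t * y ^ 3 - t * y ^ 3 * z ^ 2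
            - t ^ 2 * y * z ^ 3 + t ^ 2 * y ^ 3 * z + t ^ 3 * z - t ^ 3 * y + t ^ 3 * y * z ^ 2
            - t ^ 3 * y ^ 2 * z) * gaussPrim 1 t) =
      gaussWeight y * gaussWeight z ^ 2 *
        ((z ^ 2 - 3 / 2 * y * z + y * z ^ 3 + 1 / 2 * y ^ 2 - y ^ 2 * z ^ 2) * gaussWeight y ^ 2
          + (-2 * z + z ^ 3 + 2 * y - 2 * y * z ^ 2 + y ^ 2 * z) * gaussPrim 1 y * gaussWeight y
          + (7 / 2 * z - z ^ 3 - 7 / 2 * y + 5 * y * z ^ 2 - 5 * y ^ 2 * z + 2 * y ^ 2 * z ^ 3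
            + y ^ 3 - 2 * y ^ 3 * z ^ 2) * gaussPrim 2 y) := by
  set c := gaussWeight y * gaussWeight z ^ 2 with hc
  set a₀ := z ^ 2 + y * z ^ 3 - y ^ 2 - y ^ 3 * z with ha₀
  set a₁ := -3 / 2 * z + 3 / 2 * y - y * z ^ 2 + y ^ 2 * z with ha₁
  set b₀ := -2 * z + z ^ 3 + 2 * y - 2 * y * z ^ 2 + 2 * y ^ 2 * z - y ^ 2 * z ^ 3 - y ^ 3
    + y ^ 3 * z ^ 2 with hb₀
  set b₁ := y * z ^ 3 - y ^ 3 * z with hb₁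
  set b₂ := -z + y - y * z ^ 2 + y ^ 2 * z with hb₂
  set e := 7 / 2 * z - z ^ 3 - 7 / 2 * y + 5 * y * z ^ 2 - 5 * y ^ 2 * z + 2 * y ^ 2 * z ^ 3
    + y ^ 3 - 2 * y ^ 3 * z ^ 2 with he
  rw [integral_Iic_gaussWeight
    (g := fun t => c *
      ((2 * y * z ^ 2 - 2 * y ^ 2 * z + y ^ 2 * z ^ 3 - y ^ 3 * z ^ 2 - 2 * t * z ^ 2
        - t * y * z ^ 3 + 2 * t * y ^ 2 + t * y ^ 3 * z + 2 * t ^ 2 * z - 2 * t ^ 2 * y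
        + t ^ 2 * y * z ^ 2 - t ^ 2 * y ^ 2 * z) * gaussWeight t
      + (y * z ^ 3 - y ^ 3 * z - t * z ^ 3 + t * y ^ 2 * z ^ 3 + t * y ^ 3 - t * y ^ 3 * z ^ 2
        - t ^ 2 * y * z ^ 3 + t ^ 2 * y ^ 3 * z + t ^ 3 * z - t ^ 3 * y + t ^ 3 * y * z ^ 2
        - t ^ 3 * y ^ 2 * z) * gaussPrim 1 t))
    (B := fun t => c * ((a₀ + a₁ * t + 0 * t ^ 2) * gaussWeight t
      + (b₀ + b₁ * t + b₂ * t ^ 2) * gaussPrim 1 t)) (K := fun t => c * e * gaussPrim 2 t)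
    (by fun_prop) (by fun_prop) (by simpa using (tendsto_gaussPrim_atBot 2).const_mul (c * e))
    (fun t => by rw [hc]; ring) (fun t => ?_)]
  · rw [ha₀, ha₁, hb₀, hb₁, hb₂]; ring
  · refine (((((hasDerivAt_quadratic a₀ a₁ 0 t).mul (hasDerivAt_gaussWeight t)).add
      ((hasDerivAt_quadratic b₀ b₁ b₂ t).mul (hasDerivAt_gaussPrim 1 t))).const_mul c).mul
      (hasDerivAt_gaussWeight t) |>.add
      ((hasDerivAt_gaussPrim 2 t).const_mul (c * e))).congr_deriv ?_
    simp only [Pi.mul_apply, Pi.add_apply]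
    rw [ha₀, ha₁, hb₀, hb₁, hb₂, he]; ring

lemma integral_third_eigenvalue (z : ℝ) :
    ∫ t in Iic z, gaussWeight t * gaussWeight z ^ 2 *
        ((z ^ 2 - 3 / 2 * t * z + t * z ^ 3 + 1 / 2 * t ^ 2 - t ^ 2 * z ^ 2) * gaussWeight t ^ 2
          + (-2 * z + z ^ 3 + 2 * t - 2 * t * z ^ 2 + t ^ 2 * z) * gaussPrim 1 t * gaussWeight t
          + (7 / 2 * z - z ^ 3 - 7 / 2 * t + 5 * t * z ^ 2 - 5 * t ^ 2 * z + 2 * t ^ 2 * z ^ 3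
            + t ^ 3 - 2 * t ^ 3 * z ^ 2) * gaussPrim 2 t) =
      gaussWeight z ^ 2 *
        (3 / 2 * z * gaussWeight z ^ 3 + (3 / 2 + 3 * z ^ 2) * gaussPrim 2 z * gaussWeight z
          + (-1 + 1 / 2 * z ^ 2) * gaussPrim 1 z * gaussWeight z ^ 2
          + (z ^ 3 - 3 / 2 * z) * (gaussPrim 1 z * gaussPrim 2 z)) := by
  set c := gaussWeight z ^ 2 with hc
  rw [integral_Iic_gaussWeight
    (g := fun t => c *
      ((z ^ 2 - 3 / 2 * t * z + t * z ^ 3 + 1 / 2 * t ^ 2 - t ^ 2 * z ^ 2) * gaussWeight t ^ 2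
      + (-2 * z + z ^ 3 + 2 * t - 2 * t * z ^ 2 + t ^ 2 * z) * gaussPrim 1 t * gaussWeight t
      + (7 / 2 * z - z ^ 3 - 7 / 2 * t + 5 * t * z ^ 2 - 5 * t ^ 2 * z + 2 * t ^ 2 * z ^ 3
        + t ^ 3 - 2 * t ^ 3 * z ^ 2) * gaussPrim 2 t))
    (B := fun t => c * (((2 * z - z ^ 3) + (-1 / 2 + z ^ 2) * t + 0 * t ^ 2) * gaussWeight t ^ 2
      + ((3 / 2 - z ^ 2) + (5 * z - 2 * z ^ 3) * t + (-1 + 2 * z ^ 2) * t ^ 2) * gaussPrim 2 t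
      + ((-1 + z ^ 2) + (-1 / 2 * z) * t + 0 * t ^ 2) * (gaussPrim 1 t * gaussWeight t)))
    (K := fun t => c * (z ^ 3 - 3 / 2 * z) * (gaussPrim 1 t * gaussPrim 2 t))
    (by fun_prop) (by fun_prop)
    (by
      simpa using ((tendsto_gaussPrim_atBot 1).mul (tendsto_gaussPrim_atBot 2)).const_mul
        (c * (z ^ 3 - 3 / 2 * z)))
    (fun t => by ring) (fun t => ?_)]
  · rw [hc]; ring
  · have hp := hasDerivAt_gaussWeight t
    have hE := hasDerivAt_gaussPrim 1 t
    have hF := hasDerivAt_gaussPrim 2 t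
    refine ((((((hasDerivAt_quadratic (2 * z - z ^ 3) (-1 / 2 + z ^ 2) 0 t).mul (hp.pow 2)).add
      ((hasDerivAt_quadratic (3 / 2 - z ^ 2) (5 * z - 2 * z ^ 3) (-1 + 2 * z ^ 2) t).mul hF)).add
      ((hasDerivAt_quadratic (-1 + z ^ 2) (-1 / 2 * z) 0 t).mul (hE.mul hp))).const_mul c).mul
      hp |>.add ((hE.mul hF).const_mul (c * (z ^ 3 - 3 / 2 * z)))).congr_deriv ?_
    simp only [Pi.mul_apply, Pi.pow_apply, Pi.add_apply]
    push_cast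
    ring

lemma integral_largest_eigenvalue :
    ∫ z, gaussWeight z ^ 2 *
        (3 / 2 * z * gaussWeight z ^ 3 + (3 / 2 + 3 * z ^ 2) * gaussPrim 2 z * gaussWeight z
          + (-1 + 1 / 2 * z ^ 2) * gaussPrim 1 z * gaussWeight z ^ 2
          + (z ^ 3 - 3 / 2 * z) * (gaussPrim 1 z * gaussPrim 2 z)) =
      29 / 12 * (√(2 * π / 3) * √π / 2) - √(π / 2) * √(2 * π) / 2 := by
  set g : ℝ → ℝ := fun z => gaussWeight z *
    (3 / 2 * z * gaussWeight z ^ 3 + (3 / 2 + 3 * z ^ 2) * gaussPrim 2 z * gaussWeight z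
      + (-1 + 1 / 2 * z ^ 2) * gaussPrim 1 z * gaussWeight z ^ 2
      + (z ^ 3 - 3 / 2 * z) * (gaussPrim 1 z * gaussPrim 2 z))
    - 29 / 12 * (gaussWeight z ^ 2 * gaussPrim 2 z) + gaussWeight z ^ 3 * gaussPrim 1 z with hg
  have hgrowth : PolyGrowth g := by fun_prop
  have hzero : ∫ z, g z * gaussWeight z = 0 := by
    refine integral_gaussWeight_eq_zero hgrowth
      (B := fun t => -7 / 12 * gaussWeight t ^ 4
        + (0 + (-7 / 6) * t + 0 * t ^ 2) * (gaussPrim 2 t * gaussWeight t ^ 2)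
        + (0 + (-1 / 4) * t + 0 * t ^ 2) * (gaussPrim 1 t * gaussWeight t ^ 3)
        + (1 / 4 + 0 * t + (-1 / 2) * t ^ 2) * (gaussPrim 1 t * gaussPrim 2 t * gaussWeight t))
      (by fun_prop) fun t => ?_
    have hp := hasDerivAt_gaussWeight t
    have hE := hasDerivAt_gaussPrim 1 t
    have hF := hasDerivAt_gaussPrim 2 t
    refine ((((((hp.pow 4).const_mul (-7 / 12)).add
      ((hasDerivAt_quadratic 0 (-7 / 6) 0 t).mul (hF.mul (hp.pow 2)))).add
      ((hasDerivAt_quadratic 0 (-1 / 4) 0 t).mul (hE.mul (hp.pow 3)))).add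
      ((hasDerivAt_quadratic (1 / 4) 0 (-1 / 2) t).mul ((hE.mul hF).mul hp))).mul hp).congr_deriv ?_
    simp only [hg, Pi.mul_apply, Pi.pow_apply, Pi.add_apply]
    push_cast
    ring
  have h3 := integrable_gaussWeight_pow_mul_gaussPrim 3 2
  have h4 := integrable_gaussWeight_pow_mul_gaussPrim 4 1
  have hsplit : ∫ z, (g z * gaussWeight z + 29 / 12 * (gaussWeight z ^ 3 * gaussPrim 2 z))
      - gaussWeight z ^ 4 * gaussPrim 1 z =
      29 / 12 * (√(2 * π / 3) * √π / 2) - √(π / 2) * √(2 * π) / 2 := by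
    have hg' := hgrowth.integrable_mul_gaussWeight
    have h5 : Integrable fun z => g z * gaussWeight z +
        29 / 12 * (gaussWeight z ^ 3 * gaussPrim 2 z) := hg'.add (h3.const_mul _)
    rw [integral_sub h5 h4, integral_add hg' (h3.const_mul _), integral_const_mul, hzero,
      integral_gaussWeight_pow_mul_gaussPrim, integral_gaussWeight_pow_mul_gaussPrim,
      show π / (((3 : ℕ) : ℝ) / 2) = 2 * π / 3 by push_cast; ring,
      show π / (((2 : ℕ) : ℝ) / 2) = π by push_cast; ring,
      show π / (((4 : ℕ) : ℝ) / 2) = π / 2 by push_cast; ring,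
      show π / (((1 : ℕ) : ℝ) / 2) = 2 * π by push_cast; ring, zero_add]
  rw [← hsplit]
  congr 1 with z
  simp only [hg]
  ring

theorem stmt10 :
    (1 / (2 * Real.pi)) *
        ∫ l4 : ℝ, ∫ l3 in Set.Iic l4, ∫ l2 in Set.Iic l3, ∫ l1 in Set.Iic l2,
          Real.exp (-(l1 ^ 2) / 2) * Real.exp (-(l2 ^ 2) / 2) *
            Real.exp (-(l3 ^ 2) / 2) * Real.exp (-(l4 ^ 2)) *
            ((l2 - l1) * (l3 - l1) * (l4 - l1) * (l3 - l2) * (l4 - l2) * (l4 - l3)) =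
      (29 * Real.sqrt 6 - 36) / 144 := by
  have hw : ∀ x : ℝ, exp (-(x ^ 2) / 2) = gaussWeight x := fun _ => rfl
  simp only [hw, ← gaussWeight_sq, integral_smallest_eigenvalue, integral_second_eigenvalue,
    integral_third_eigenvalue, integral_largest_eigenvalue]
  have h1 : √(2 * π / 3) * √π = π * √6 / 3 := by
    rw [← sqrt_mul (by positivity), show 2 * π / 3 * π = (π / 3) ^ 2 * 6 by ring,
      sqrt_mul (by positivity), sqrt_sq (by positivity)]
    ring
  have h2 : √(π / 2) * √(2 * π) = π := by
    rw [← sqrt_mul (by positivity), show π / 2 * (2 * π) = π ^ 2 by ring, sqrt_sq pi_pos.le]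
  rw [h1, h2]
  field_simp
  ring
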